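/- Let W be an n-dimensional vector space, 𝓔=(E^1_•,…,E^s_•) ∈ Fl(W)^s, and S ⊆ V ⊆ W subspaces with dim(V)=r and dim(S)=d. Let 𝓘=(I^1,…,I^s) be the unique s-tuple of subsets of [n], each of cardinality r, with V ∈ ∩_{j=1}^{s} Ω°_{I^j}(E^j_•), and let 𝓚=(K^1,…,K^s) be the unique s-tuple of subsets of [r], each of cardinality d, with S ∈ ∩_{j=1}^{s} Ω°_{K^j}(E^j_•(V)). Then dim(S,V,𝓔(V)) − dim(S,W,𝓔) = Σ_{j=1}^{s} Σ_{a∈K^j}(n−r+a−i^j_a) − d(n−r). -/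

import Mathlib

noncomputable section

open Module Submodule

/-! ### Polynomial functions and the Zariski topology on a vector space -/

/-- Evaluation of a polynomial in linear functionals at a point of a vector space.
These are exactly the polynomial functions on a finite-dimensional vector space. -/
def mEval (k : Type*) {M : Type*} [Field k] [AddCommGroup M] [Module k M]
    (x : M) (p : MvPolynomial (Module.Dual k M) k) : k :=
  MvPolynomial.eval (fun l : Module.Dual k M => l x) p

/-- The Zariski topology on a (finite-dimensional) vector space, generated by the
complements of zero sets of polynomial functions. -/
def mZariski (k M : Type*) [Field k] [AddCommGroup M] [Module k M] :
    TopologicalSpace M :=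
  TopologicalSpace.generateFrom
    {U : Set M | ∃ p : MvPolynomial (Module.Dual k M) k, U = {x : M | mEval k x p ≠ 0}}

/-- The Zariski tangent space at a point `x` to a subset `A` of a vector space:
the common kernel of the differentials at `x` of all polynomial functions vanishing on `A`. -/
def mTangent (k : Type*) {M : Type*} [Field k] [AddCommGroup M] [Module k M]
    (A : Set M) (x : M) : Submodule k M :=
  letI := Classical.decEq (Module.Dual k M)
  ⨅ p ∈ {p : MvPolynomial (Module.Dual k M) k | ∀ a ∈ A, mEval k a p = 0},
    LinearMap.ker (∑ l ∈ p.vars, mEval k x (MvPolynomial.pderiv l p) • (l : Module.Dual k M))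

/-- `f : M → N` is a polynomial map on a subset `A ⊆ M`. -/
def IsPolyOn (k : Type*) {M N : Type*} [Field k] [AddCommGroup M] [Module k M]
    [AddCommGroup N] [Module k N] (A : Set M) (f : M → N) : Prop :=
  ∀ l : Module.Dual k N, ∃ p : MvPolynomial (Module.Dual k M) k, ∀ x ∈ A, l (f x) = mEval k x p

/-- Dimension (topological Krull dimension) of a subset of a topological space. -/
def subDim {α : Type*} (t : TopologicalSpace α) (C : Set α) : WithBot ℕ∞ :=
  @topologicalKrullDim C (TopologicalSpace.induced (Subtype.val : C → α) t)

/-- The irreducible components of a subset `A` of a topological space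
(for the subspace topology). -/
def subComponents {α : Type*} (t : TopologicalSpace α) (A : Set α) : Set (Set ↥A) :=
  @irreducibleComponents A (TopologicalSpace.induced (Subtype.val : A → α) t)

/-- Dimension of a subset `C` of a subspace `A` of a topological space. -/
def compDim {α : Type*} (t : TopologicalSpace α) (A : Set α) (C : Set ↥A) : WithBot ℕ∞ :=
  subDim (TopologicalSpace.induced (Subtype.val : A → α) t) C

/-! ### Flags, Schubert cells and Schubert varieties -/

/-- A complete flag on a finite-dimensional vector space, recorded as the increasing
function sending `m` to the `m`-th member (of dimension `m`) of the flag. -/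
def IsFlag {k M : Type*} [Field k] [AddCommGroup M] [Module k M]
    (E : ℕ → Submodule k M) : Prop :=
  Monotone E ∧ ∀ m : ℕ, finrank k ↥(E m) = min m (finrank k M)

/-- Membership of `V` in the (open) Schubert cell `Ω°_I(E_•) ⊆ Gr(r, M)` attached to the
subset `I ⊆ [n]` recorded by the strictly increasing tuple `i : Fin r → Fin n`
(`0`-indexed: the `1`-based subset is `{i a + 1}`): `dim (V ∩ E_u) = #{a | i_a ≤ u}`. -/
def cellMem {k M : Type*} [Field k] [AddCommGroup M] [Module k M] {n r : ℕ}
    (i : Fin r → Fin n) (E : ℕ → Submodule k M) (V : Submodule k M) : Prop :=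
  finrank k ↥V = r ∧
    ∀ u : ℕ, u ≤ n →
      finrank k ↥(V ⊓ E u) =
        (Finset.univ.filter (fun a : Fin r => (i a : ℕ) + 1 ≤ u)).card

/-- Membership of `V` in the (closed) Schubert variety `Ω_I(E_•) ⊆ Gr(r, M)`:
`dim (V ∩ E_{i_a}) ≥ a` for `a = 1, …, r`. -/
def varMem {k M : Type*} [Field k] [AddCommGroup M] [Module k M] {n r : ℕ}
    (i : Fin r → Fin n) (E : ℕ → Submodule k M) (V : Submodule k M) : Prop :=
  finrank k ↥V = r ∧ ∀ a : Fin r, (a : ℕ) + 1 ≤ finrank k ↥(V ⊓ E ((i a : ℕ) + 1))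

/-- The flag induced on a subspace `V` by a flag `E` on `M`: its `a`-th member is the
smallest subspace of the form `V ∩ E_u` of dimension `≥ a`. -/
def indSub {k M : Type*} [Field k] [AddCommGroup M] [Module k M]
    (E : ℕ → Submodule k M) (V : Submodule k M) : ℕ → Submodule k ↥V := fun a =>
  ⨅ u ∈ {u : ℕ | a ≤ finrank k ↥(Submodule.comap V.subtype (E u))},
    Submodule.comap V.subtype (E u)

/-- The flag induced on the quotient `M ⧸ V` by a flag `E` on `M`: its `b`-th member is
the smallest subspace of the form `(E_u + V)/V` of dimension `≥ b`. -/
def indQuot {k M : Type*} [Field k] [AddCommGroup M] [Module k M]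
    (E : ℕ → Submodule k M) (V : Submodule k M) : ℕ → Submodule k (M ⧸ V) := fun b =>
  ⨅ u ∈ {u : ℕ | b ≤ finrank k ↥(Submodule.map V.mkQ (E u))},
    Submodule.map V.mkQ (E u)

/-- The flag spanned by a tuple of vectors (a complete flag when the tuple is a basis). -/
def spanFlag (k : Type*) {M : Type*} [Field k] [AddCommGroup M] [Module k M] {r : ℕ}
    (b : Fin r → M) : ℕ → Submodule k M := fun m =>
  Submodule.span k (b '' {a : Fin r | (a : ℕ) < m})

/-- `P` holds for a generic point of `Fl(M)^s` (`r = dim M`): there is a nonempty Zariski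
open set of `s`-tuples of bases of `M` on which the associated tuples of complete flags
satisfy `P`. -/
def GenericFlags (k : Type*) {M : Type*} [Field k] [AddCommGroup M] [Module k M]
    (s r : ℕ) (P : (Fin s → ℕ → Submodule k M) → Prop) : Prop :=
  ∃ U : Set (Fin s → Fin r → M),
    @IsOpen _ (mZariski k (Fin s → Fin r → M)) U ∧
    (∃ b ∈ U, ∀ j, LinearIndependent k (b j)) ∧
    ∀ b ∈ U, (∀ j, LinearIndependent k (b j)) → P (fun j => spanFlag k (b j))

/-- `P` holds for a generic point of `Fl(M)^s × Fl(Q)^s` (`r = dim M`, `q = dim Q`). -/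
def GenericFlagPairs (k : Type*) {M Q : Type*} [Field k] [AddCommGroup M] [Module k M]
    [AddCommGroup Q] [Module k Q] (s r q : ℕ)
    (P : (Fin s → ℕ → Submodule k M) → (Fin s → ℕ → Submodule k Q) → Prop) : Prop :=
  ∃ U : Set ((Fin s → Fin r → M) × (Fin s → Fin q → Q)),
    @IsOpen _ (mZariski k ((Fin s → Fin r → M) × (Fin s → Fin q → Q))) U ∧
    (∃ b ∈ U, (∀ j, LinearIndependent k (b.1 j)) ∧ ∀ j, LinearIndependent k (b.2 j)) ∧
    ∀ b ∈ U, ((∀ j, LinearIndependent k (b.1 j)) ∧ ∀ j, LinearIndependent k (b.2 j)) →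
      P (fun j => spanFlag k (b.1 j)) (fun j => spanFlag k (b.2 j))

/-! ### The spaces `Hom_𝓘(V, Q, 𝓕, 𝓖)` -/

/-- The subspace `{φ : M →ₗ Q | φ(p) ⊆ q}` of `Hom(M, Q)`. -/
def homConstraint {k M Q : Type*} [Field k] [AddCommGroup M] [Module k M]
    [AddCommGroup Q] [Module k Q] (p : Submodule k M) (q : Submodule k Q) :
    Submodule k (M →ₗ[k] Q) :=
  LinearMap.ker ((LinearMap.llcomp k ↥p Q (Q ⧸ q) q.mkQ).comp (LinearMap.lcomp k Q p.subtype))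

/-- `Hom_𝓘(M, Q, F, G) = {φ | φ(F^j_a) ⊆ G^j_{i^j_a - a} for all a = 1, …, r, j = 1, …, s}`. -/
def homSpace {k M Q : Type*} [Field k] [AddCommGroup M] [Module k M]
    [AddCommGroup Q] [Module k Q] {n r s : ℕ} (I : Fin s → Fin r → Fin n)
    (F : Fin s → ℕ → Submodule k M) (G : Fin s → ℕ → Submodule k Q) :
    Submodule k (M →ₗ[k] Q) :=
  ⨅ j : Fin s, ⨅ a : Fin r,
    homConstraint (F j ((a : ℕ) + 1)) (G j ((I j a : ℕ) - (a : ℕ)))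

/-! ### Charts on the Grassmannian, tangent spaces to Schubert cells -/

/-- The graph of `ψ : V →ₗ C`, a point of the Grassmannian chart around `V`
determined by a complement `C` of `V`. -/
def graphMap {k M : Type*} [Field k] [AddCommGroup M] [Module k M]
    (V C : Submodule k M) (ψ : ↥V →ₗ[k] ↥C) : Submodule k M :=
  LinearMap.range (V.subtype + C.subtype ∘ₗ ψ)

/-- The canonical identification `Hom(V, C) ≃ Hom(V, M/V)` (derivative of the chart). -/
def conjMap {k M : Type*} [Field k] [AddCommGroup M] [Module k M]
    (V C : Submodule k M) : (↥V →ₗ[k] ↥C) →ₗ[k] (↥V →ₗ[k] M ⧸ V) :=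
  LinearMap.llcomp k ↥V ↥C (M ⧸ V) (V.mkQ ∘ₗ C.subtype)

/-- The tangent space at `V` to a set `S` of points of the Grassmannian `Gr(r, M)`,
computed in the chart determined by a complement `C` of `V` and viewed inside
`Hom(V, M/V)` via the canonical identification. -/
def grTangent {k M : Type*} [Field k] [AddCommGroup M] [Module k M]
    (S : Set (Submodule k M)) (V C : Submodule k M) :
    Submodule k (↥V →ₗ[k] (M ⧸ V)) :=
  Submodule.map (conjMap V C)
    (mTangent k {ψ : ↥V →ₗ[k] ↥C | graphMap V C ψ ∈ S} 0)

/-- The Zariski topology on the Grassmannian of `r`-dimensional subspaces of `M`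
(as a topology on `Submodule k M`), coinduced from the Stiefel parameterization by
spanning `r`-tuples. -/
def grTop (k : Type*) {M : Type*} [Field k] [AddCommGroup M] [Module k M] (r : ℕ) :
    TopologicalSpace (Submodule k M) :=
  TopologicalSpace.coinduced (fun b : Fin r → M => Submodule.span k (Set.range b))
    (mZariski k (Fin r → M))

/-! ### Numerical quantities -/

/-- `codim ω_I = ∑_{a=1}^r (n - r + a - i_a)` (as an integer). -/
def codimZ (n r : ℕ) (i : Fin r → Fin n) : ℤ :=
  ∑ a : Fin r, ((n : ℤ) - (r : ℤ) + ((a : ℕ) : ℤ) - ((i a : ℕ) : ℤ))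

/-- The quantity `∑_j ∑_{a ∈ K^j} (n - r + a - i^j_a) - d(n - r)` of Inequality `(†^𝓘_𝓚)`. -/
def daggerZ (n r d : ℕ) {s : ℕ} (I : Fin s → Fin r → Fin n)
    (K : Fin s → Fin d → Fin r) : ℤ :=
  (∑ j : Fin s, ∑ t : Fin d,
      ((n : ℤ) - (r : ℤ) + ((K j t : ℕ) : ℤ) - ((I j (K j t) : ℕ) : ℤ)))
    - (d : ℤ) * ((n : ℤ) - (r : ℤ))

/-- The expected dimension `dim(S, M, 𝓕) = d(m - d) - ∑_j ∑_{t=1}^d (m - d + t - k^j_t)`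
of an intersection of Schubert cells `Ω°_{K^j}` in `Gr(d, m)`. -/
def eDimZ {s : ℕ} (m d : ℕ) (K : Fin s → Fin d → Fin m) : ℤ :=
  (d : ℤ) * ((m : ℤ) - (d : ℤ)) -
    ∑ j : Fin s, ∑ t : Fin d,
      ((m : ℤ) - (d : ℤ) + ((t : ℕ) : ℤ) - ((K j t : ℕ) : ℤ))

/-- `codim ω_I` as a natural number. -/
def codimN (n r : ℕ) (i : Fin r → Fin n) : ℕ :=
  ∑ a : Fin r, ((n - r + (a : ℕ)) - (i a : ℕ))

/-! ### The cohomology ring of the Grassmannian, Schubert classes -/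

/-- The ideal `(h_{n-r+1}, …, h_n)` of the polynomial ring in `r` variables
(`h_m` the complete homogeneous symmetric polynomials). -/
def grassIdeal (r n : ℕ) : Ideal (MvPolynomial (Fin r) ℤ) :=
  Ideal.span ((fun m : ℕ => MvPolynomial.hsymm (Fin r) ℤ m) '' Set.Icc (n - r + 1) n)

/-- A presentation of the cohomology (Chow) ring `H^*(Gr(r,n))`: products of Schubert
classes vanish here exactly when they vanish in `H^*(Gr(r,n))`. -/
abbrev grassRing (r n : ℕ) : Type :=
  MvPolynomial (Fin r) ℤ ⧸ grassIdeal r n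

/-- `h_m` for an integer `m` (zero for negative `m`). -/
def hkZ (r : ℕ) (m : ℤ) : MvPolynomial (Fin r) ℤ :=
  if 0 ≤ m then MvPolynomial.hsymm (Fin r) ℤ m.toNat else 0

/-- The Schur polynomial (Jacobi–Trudi determinant) of the partition
`λ_a = n - r + a - i_a` attached to the subset `I ⊆ [n]` recorded by `i`. -/
def schurI {n r : ℕ} (i : Fin r → Fin n) : MvPolynomial (Fin r) ℤ :=
  Matrix.det (Matrix.of fun a b : Fin r =>
    hkZ r ((n : ℤ) - (r : ℤ) + ((b : ℕ) : ℤ) - ((i a : ℕ) : ℤ)))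

/-- The Schubert class `ω_I ∈ H^*(Gr(r,n))` of the subset `I ⊆ [n]` recorded by the
strictly increasing tuple `i : Fin r → Fin n`. -/
def omegaCls {n r : ℕ} (i : Fin r → Fin n) : grassRing r n :=
  Ideal.Quotient.mk (grassIdeal r n) (schurI i)

/-- The class of a point in `H^*(Gr(r,n))`: the Schubert class of `I = {1, …, r}`. -/
def pointCls (r n : ℕ) (h : r ≤ n) : grassRing r n :=
  omegaCls (fun a : Fin r => Fin.castLE h a)

/-! ### Schur polynomials of partitions, Littlewood–Richardson coefficients -/

/-- The Schur polynomial of a partition with at most `r` parts, via Jacobi–Trudi. -/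
def schurP {r : ℕ} (lam : Fin r → ℕ) : MvPolynomial (Fin r) ℤ :=
  Matrix.det (Matrix.of fun a b : Fin r =>
    hkZ r (((lam a : ℕ) : ℤ) - ((a : ℕ) : ℤ) + ((b : ℕ) : ℤ)))

/-- The Vandermonde alternant `a_δ = det(x_a^{r-1-b})`. -/
def alternant (r : ℕ) : MvPolynomial (Fin r) ℤ :=
  Matrix.det (Matrix.of fun a b : Fin r => (MvPolynomial.X a) ^ (r - 1 - (b : ℕ)))

/-- The coefficient of the Schur polynomial `s_δ` in a symmetric polynomial `f`
(in `r` variables): the coefficient of the monomial `x^{δ + (r-1, …, 1, 0)}` in `f ⬝ a_δ`. -/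
def schurCoeff (r : ℕ) (f : MvPolynomial (Fin r) ℤ) (δ : Fin r → ℕ) : ℤ :=
  MvPolynomial.coeff
    (Finsupp.equivFunOnFinite.symm (fun a : Fin r => δ a + (r - 1 - (a : ℕ))))
    (f * alternant r)

/-- The Littlewood–Richardson coefficient `c^λ_{μ,ν}` (partitions with at most `r` parts):
the multiplicity of `V_λ` in `V_μ ⊗ V_ν`, i.e. of `s_λ` in `s_μ s_ν`. -/
def lrCoeff (r : ℕ) (lam mu nu : Fin r → ℕ) : ℤ :=
  schurCoeff r (schurP mu * schurP nu) lam

/-- The multiplicity of `V_δ` in `V_{Λ 1} ⊗ ⋯ ⊗ V_{Λ t}` (as `GL(r)`-representations),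
i.e. of `s_δ` in `∏_j s_{Λ j}`. -/
def multiCoeff (r : ℕ) {t : ℕ} (Λ : Fin t → Fin r → ℕ) (δ : Fin r → ℕ) : ℤ :=
  schurCoeff r (∏ j : Fin t, schurP (Λ j)) δ


/-- For a strictly increasing tuple, `f a ≤ u` (1-based) iff `a` is among the first
`#{b | f b ≤ u}` indices. -/
theorem StrictMono.succ_le_iff_succ_le_card {n r : ℕ} {f : Fin r → Fin n} (hf : StrictMono f)
    (u : ℕ) (a : Fin r) :
    (f a : ℕ) + 1 ≤ u ↔
      (a : ℕ) + 1 ≤ (Finset.univ.filter (fun b : Fin r => (f b : ℕ) + 1 ≤ u)).card := by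
  constructor
  · intro h
    rw [← Fin.card_Iic a]
    refine Finset.card_le_card fun b hb => ?_
    have hba : f b ≤ f a := hf.monotone (Finset.mem_Iic.mp hb)
    simp only [Finset.mem_filter, Finset.mem_univ, true_and]
    have : (f b : ℕ) ≤ f a := hba
    omega
  · intro h
    by_contra hu
    have hsub : (Finset.univ.filter (fun b : Fin r => (f b : ℕ) + 1 ≤ u)) ⊆ Finset.Iio a := by
      intro b hb
      simp only [Finset.mem_filter, Finset.mem_univ, true_and] at hb
      have hlt : f b < f a := Fin.lt_def.mpr (by omega)
      exact Finset.mem_Iio.mpr (hf.lt_iff_lt.mp hlt)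
    have hcard := Finset.card_le_card hsub
    rw [Fin.card_Iio] at hcard
    omega

/-- A strictly increasing tuple is determined by its counting function. -/
theorem StrictMono.eq_of_card_filter_eq {n r : ℕ} {f g : Fin r → Fin n} (hf : StrictMono f)
    (hg : StrictMono g)
    (h : ∀ u ≤ n, (Finset.univ.filter (fun b : Fin r => (f b : ℕ) + 1 ≤ u)).card =
      (Finset.univ.filter (fun b : Fin r => (g b : ℕ) + 1 ≤ u)).card) :
    f = g := by
  have key : ∀ u ≤ n, ∀ a, (f a : ℕ) + 1 ≤ u ↔ (g a : ℕ) + 1 ≤ u := fun u hu a => by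
    rw [hf.succ_le_iff_succ_le_card, hg.succ_le_iff_succ_le_card, h u hu]
  ext a
  have h₁ := (key (f a + 1) (f a).isLt a).mp le_rfl
  have h₂ := (key (g a + 1) (g a).isLt a).mpr le_rfl
  omega

/-- The dimension of the trace on `V` of a subspace. -/
theorem finrank_comap_subtype_eq {k M : Type*} [Field k] [AddCommGroup M] [Module k M]
    (V A : Submodule k M) :
    finrank k ↥(Submodule.comap V.subtype A) = finrank k ↥(V ⊓ A) := by
  rw [← Submodule.map_comap_subtype]
  exact (Submodule.equivMapOfInjective V.subtype V.injective_subtype _).finrank_eq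

/-- The member of the induced flag of index `dim (V ∩ E_u)` is `V ∩ E_u`. -/
theorem indSub_finrank {k M : Type*} [Field k] [AddCommGroup M] [Module k M]
    [FiniteDimensional k M] {E : ℕ → Submodule k M} (hE : Monotone E) (V : Submodule k M)
    (u : ℕ) :
    indSub E V (finrank k ↥(V ⊓ E u)) = Submodule.comap V.subtype (E u) := by
  rw [← finrank_comap_subtype_eq]
  unfold indSub
  refine le_antisymm (biInf_le (fun v => Submodule.comap V.subtype (E v)) ?_)
    (le_iInf₂ fun v hv => ?_)
  · exact le_refl (finrank k ↥(Submodule.comap V.subtype (E u)))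
  rcases le_total u v with huv | hvu
  · exact Submodule.comap_mono (hE huv)
  · exact (Submodule.eq_of_le_of_finrank_le (Submodule.comap_mono (hE hvu)) hv).ge

/-- If `V` has position `i` with respect to `E` and `S ⊆ V` has position `κ` with respect to
the induced flag on `V`, then `S` has position `i ∘ κ` with respect to `E`. -/
theorem cellMem.comp {k M : Type*} [Field k] [AddCommGroup M] [Module k M]
    [FiniteDimensional k M] {n r d : ℕ} {E : ℕ → Submodule k M} (hE : Monotone E)
    {S V : Submodule k M} (hSV : S ≤ V) {i : Fin r → Fin n} (hi : StrictMono i)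
    (hV : cellMem i E V) {κ : Fin d → Fin r}
    (hS : cellMem κ (indSub E V) (Submodule.comap V.subtype S)) :
    cellMem (i ∘ κ) E S := by
  refine ⟨?_, fun u hu => ?_⟩
  · rw [← hS.1, finrank_comap_subtype_eq, inf_eq_right.mpr hSV]
  · have hle : finrank k ↥(V ⊓ E u) ≤ r :=
      hV.1 ▸ Submodule.finrank_mono inf_le_left
    have h := hS.2 _ hle
    rw [indSub_finrank hE, ← Submodule.comap_inf, finrank_comap_subtype_eq,
      inf_eq_right.mpr (inf_le_left.trans hSV), hV.2 u hu] at h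
    rw [h]
    congr 1
    ext t
    simp only [Finset.mem_filter, Finset.mem_univ, true_and, Function.comp_apply]
    exact (hi.succ_le_iff_succ_le_card u (κ t)).symm

/-- Proposition `l2` (1).  With `S ⊆ V ⊆ W`, `𝓔 ∈ Fl(W)^s`, and
`𝓘, 𝓚, 𝓛` the (unique) tuples of subsets such that `V ∈ ∩_j Ω°_{I^j}(E^j_•)`,
`S ∈ ∩_j Ω°_{K^j}(E^j_•(V))` and `S ∈ ∩_j Ω°_{L^j}(E^j_•)`, one has
`dim(S,V,𝓔(V)) - dim(S,W,𝓔) = ∑_j ∑_{a ∈ K^j}(n-r+a-i^j_a) - d(n-r)`. -/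
theorem stmt6 (k : Type) [Field k] [IsAlgClosed k]
    {W : Type} [AddCommGroup W] [Module k W] [FiniteDimensional k W]
    (n r d s : ℕ) (hs : 0 < s) (hW : Module.finrank k W = n)
    (E : Fin s → ℕ → Submodule k W) (hE : ∀ j, IsFlag (E j))
    (S V : Submodule k W) (hSV : S ≤ V)
    (hVr : Module.finrank k ↥V = r) (hSd : Module.finrank k ↥S = d)
    (I : Fin s → Fin r → Fin n) (hI : ∀ j, StrictMono (I j))
    (hV : ∀ j, cellMem (I j) (E j) V)
    (K : Fin s → Fin d → Fin r) (hK : ∀ j, StrictMono (K j))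
    (hSK : ∀ j, cellMem (K j) (indSub (E j) V) (Submodule.comap V.subtype S))
    (L : Fin s → Fin d → Fin n) (hL : ∀ j, StrictMono (L j))
    (hSL : ∀ j, cellMem (L j) (E j) S) :
    eDimZ r d K - eDimZ n d L = daggerZ n r d I K := by
  have hLIK : ∀ j t, L j t = I j (K j t) := fun j t =>
    congrFun ((hL j).eq_of_card_filter_eq ((hI j).comp (hK j)) fun u hu => by
      rw [← (hSL j).2 u hu, ((hV j).comp (hE j).1 hSV (hI j) (hSK j)).2 u hu]) t
  simp only [eDimZ, daggerZ, hLIK, Finset.sum_add_distrib, Finset.sum_sub_distrib]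
  simp only [Finset.sum_const, Finset.card_univ, Fintype.card_fin, nsmul_eq_mul]
  ring

end
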